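/- Fix a natural number k and integers r, s, n, m, and assume that u(n−(r−s)k+(r−s)j) ≠ 0 and u(n−r+s−(r−s)k+(r−s)j) ≠ 0 for every j with 0 ≤ j ≤ k. Then u(n)·u(n−(r−s)(k+1))·u(r−s)·∑_{j=0}^{k} q^{(r−s)j}·w(m+r)^{k−j}·w(m+s)^j·w(n+m+s−(r−s)k+(r−s)j)/(u(n−(r−s)k+(r−s)j)·u(n−r+s−(r−s)k+(r−s)j)) = u(n)·w(m+r)^{k+1} − q^{(r−s)(k+1)}·u(n−(r−s)(k+1))·w(m+s)^{k+1}. -/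

import Mathlib

/-- Over a field with `q ≠ 0`, a two-sided second-order linear recurrence vanishing at two
consecutive indices vanishes identically. -/
theorem eq_zero_of_recurrence {K : Type*} [Field K] {p q : K} (hq : q ≠ 0) {f : ℤ → K}
    (hf : ∀ n : ℤ, f n = p * f (n - 1) - q * f (n - 2)) {c : ℤ}
    (h0 : f c = 0) (h1 : f (c + 1) = 0) (n : ℤ) : f n = 0 := by
  have key : f n = 0 ∧ f (n + 1) = 0 := by
    induction n using Int.inductionOn' (b := c) with
    | zero => exact ⟨h0, h1⟩
    | succ n _ ih =>
      refine ⟨ih.2, ?_⟩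
      rw [hf, show n + 1 + 1 - 1 = n + 1 by ring, show n + 1 + 1 - 2 = n by ring, ih.1, ih.2]
      ring
    | pred n _ ih =>
      have h := hf (n + 1)
      rw [show n + 1 - 1 = n by ring, show n + 1 - 2 = n - 1 by ring, ih.1, ih.2] at h
      have h' : q * f (n - 1) = 0 := by linear_combination h
      exact ⟨(mul_eq_zero.mp h').resolve_left hq, by rw [sub_add_cancel]; exact ih.1⟩
  exact key.1

/-- The addition formula expressing a Horadam sequence through the Lucas sequence. -/
theorem horadam_add {K : Type*} [Field K] {p q : K} (hq : q ≠ 0) {w u : ℤ → K}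
    (hw : ∀ n : ℤ, w n = p * w (n - 1) - q * w (n - 2))
    (hu0 : u 0 = 0) (hu1 : u 1 = 1)
    (hu : ∀ n : ℤ, u n = p * u (n - 1) - q * u (n - 2)) (n m : ℤ) :
    w (n + m) = u n * w (m + 1) - q * u (n - 1) * w m := by
  have hneg : q * u (-1) = -1 := by
    have h := hu 1
    norm_num [hu0, hu1] at h
    linear_combination h
  refine sub_eq_zero.mp (eq_zero_of_recurrence (p := p) hq
    (f := fun n => w (n + m) - (u n * w (m + 1) - q * u (n - 1) * w m))
    (fun n => ?_) (c := 0) ?_ ?_ n)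
  · have h1 := hw (n + m)
    have h2 := hu n
    have h3 := hu (n - 1)
    rw [show n + m - 1 = n - 1 + m by ring, show n + m - 2 = n - 2 + m by ring] at h1
    rw [show n - 1 - 2 = n - 2 - 1 by ring] at h3
    rw [show n - 1 - 1 = n - 2 by ring] at h3 ⊢
    linear_combination h1 - w (m + 1) * h2 + q * w m * h3
  · simp only [zero_add, zero_sub, hu0]
    linear_combination w m * hneg
  · simp [hu0, hu1, add_comm]

/-- Cassini's identity for the Lucas sequence. -/
theorem lucas_cassini {K : Type*} [Field K] {p q : K} (hq : q ≠ 0) {u : ℤ → K}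
    (hu0 : u 0 = 0) (hu1 : u 1 = 1)
    (hu : ∀ n : ℤ, u n = p * u (n - 1) - q * u (n - 2)) (d : ℤ) :
    u (d + 1) ^ 2 - u (d + 2) * u d = q ^ d := by
  have step (d : ℤ) : u (d + 1 + 1) ^ 2 - u (d + 1 + 2) * u (d + 1) =
      q * (u (d + 1) ^ 2 - u (d + 2) * u d) := by
    have h1 := hu (d + 2)
    have h2 := hu (d + 1 + 2)
    rw [show d + 2 - 1 = d + 1 by ring, show d + 2 - 2 = d by ring] at h1
    rw [show d + 1 + 2 - 1 = d + 2 by ring, show d + 1 + 2 - 2 = d + 1 by ring] at h2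
    rw [show d + 1 + 1 = d + 2 by ring, h2]
    linear_combination u (d + 2) * h1
  induction d using Int.induction_on with
  | zero => simp [hu0, hu1]
  | succ d ih => rw [step, ih, zpow_add_one₀ hq, mul_comm]
  | pred d ih =>
    have h := step (-(d : ℤ) - 1)
    rw [sub_add_cancel, ih] at h
    rw [sub_add_cancel, zpow_sub_one₀ hq, h]
    field_simp

/-- d'Ocagne's identity for the Lucas sequence. -/
theorem lucas_docagne {K : Type*} [Field K] {p q : K} (hq : q ≠ 0) {u : ℤ → K}
    (hu0 : u 0 = 0) (hu1 : u 1 = 1)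
    (hu : ∀ n : ℤ, u n = p * u (n - 1) - q * u (n - 2)) (n d : ℤ) :
    q ^ d * u (n - d) = u n * u (d + 1) - u (n + 1) * u d := by
  refine sub_eq_zero.mp (eq_zero_of_recurrence (p := p) hq
    (f := fun n => q ^ d * u (n - d) - (u n * u (d + 1) - u (n + 1) * u d))
    (fun n => ?_) (c := d) ?_ ?_ n)
  · have h1 := hu (n - d)
    have h2 := hu n
    have h3 := hu (n + 1)
    rw [show n - d - 1 = n - 1 - d by ring, show n - d - 2 = n - 2 - d by ring] at h1
    rw [show n + 1 - 1 = n - 1 + 1 by ring, show n + 1 - 2 = n - 2 + 1 by ring] at h3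
    linear_combination q ^ d * h1 - u (d + 1) * h2 + u d * h3
  · simp only [sub_self, hu0]
    ring
  · have h := lucas_cassini hq hu0 hu1 hu d
    simp only [add_sub_cancel_left, hu1, show d + 1 + 1 = d + 2 by ring]
    linear_combination -h

/-- The three-term index-shift identity linking a Horadam sequence and the Lucas sequence. -/
theorem lucas_mul_horadam_add {K : Type*} [Field K] {p q : K} (hq : q ≠ 0) {w u : ℤ → K}
    (hw : ∀ n : ℤ, w n = p * w (n - 1) - q * w (n - 2))
    (hu0 : u 0 = 0) (hu1 : u 1 = 1)
    (hu : ∀ n : ℤ, u n = p * u (n - 1) - q * u (n - 2)) (n m d : ℤ) :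
    u d * w (n + m) = u n * w (d + m) - q ^ d * u (n - d) * w m := by
  rw [lucas_docagne hq hu0 hu1 hu, horadam_add hq hw hu0 hu1 hu n,
    horadam_add hq hw hu0 hu1 hu d]
  have h1 := hu (d + 1)
  have h2 := hu (n + 1)
  rw [add_sub_cancel_right, show d + 1 - 2 = d - 1 by ring] at h1
  rw [add_sub_cancel_right, show n + 1 - 2 = n - 1 by ring] at h2
  linear_combination w m * (u n * h1 - u d * h2)


theorem stmt_18 (p q a b : ℂ) (hq : q ≠ 0) (w u : ℤ → ℂ)
    (hw0 : w 0 = a) (hw1 : w 1 = b)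
    (hw : ∀ n : ℤ, w n = p * w (n - 1) - q * w (n - 2))
    (hu0 : u 0 = 0) (hu1 : u 1 = 1)
    (hu : ∀ n : ℤ, u n = p * u (n - 1) - q * u (n - 2))
    (k : ℕ) (r s n m : ℤ)
    (hne1 : ∀ j : ℕ, j ≤ k → u (n - (r - s) * k + (r - s) * j) ≠ 0)
    (hne2 : ∀ j : ℕ, j ≤ k → u (n - r + s - (r - s) * k + (r - s) * j) ≠ 0) :
    u n * u (n - (r - s) * (k + 1)) * u (r - s) * ∑ j ∈ Finset.range (k + 1), q ^ ((r - s) * (j : ℤ)) * w (m + r) ^ (k - j) * w (m + s) ^ j * w (n + m + s - (r - s) * k + (r - s) * j) / (u (n - (r - s) * k + (r - s) * j) * u (n - r + s - (r - s) * k + (r - s) * j)) = u n * w (m + r) ^ (k + 1) - q ^ ((r - s) * ((k : ℤ) + 1)) * u (n - (r - s) * (k + 1)) * w (m + s) ^ (k + 1) := by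
  set d : ℤ := r - s with hd
  have hfirst : u (n - d * (k + 1)) ≠ 0 := by
    have h := hne2 0 k.zero_le
    rwa [show n - r + s - d * k + d * (0 : ℕ) = n - d * (k + 1) by push_cast; rw [hd]; ring] at h
  have hlast : u n ≠ 0 := by
    have h := hne1 k le_rfl
    rwa [sub_add_cancel] at h
  let f : ℕ → ℂ := fun j =>
    q ^ (d * (j : ℤ)) * w (m + r) ^ (k + 1 - j) * w (m + s) ^ j / u (n - d * (k + 1) + d * j)
  rw [mul_assoc, Finset.mul_sum, Finset.sum_congr rfl (g := fun j => f j - f (j + 1)),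
    Finset.sum_range_sub']
  · simp only [f, Nat.cast_zero, mul_zero, add_zero, zpow_zero, pow_zero, Nat.sub_zero,
      Nat.sub_self, Nat.cast_add, Nat.cast_one, sub_add_cancel]
    field_simp
  · intro j hj
    have hjk : j ≤ k := Nat.lt_succ_iff.mp (Finset.mem_range.mp hj)
    have h1 := hne1 j hjk
    have h2 := hne2 j hjk
    have key := lucas_mul_horadam_add hq hw hu0 hu1 hu (n - d * k + d * j) (m + s) d
    rw [show n - d * k + d * j + (m + s) = n + m + s - d * k + d * j by ring,
      show d + (m + s) = m + r by rw [hd]; ring,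
      show n - d * k + d * j - d = n - r + s - d * k + d * j by rw [hd]; ring] at key
    simp only [f]
    rw [show n - d * (k + 1) + d * j = n - r + s - d * k + d * j by rw [hd]; ring,
      show n - d * (k + 1) + d * ((j + 1 : ℕ) : ℤ) = n - d * k + d * j by push_cast; ring,
      show d * ((j + 1 : ℕ) : ℤ) = d * j + d by push_cast; ring, zpow_add₀ hq,
      show k + 1 - j = k - j + 1 by omega, show k + 1 - (j + 1) = k - j by omega,
      pow_succ, pow_succ, div_sub_div _ _ h2 h1, mul_div_assoc',
      mul_comm (u (n - d * k + d * j))]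
    congr 1
    linear_combination q ^ (d * (j : ℤ)) * w (m + r) ^ (k - j) * w (m + s) ^ j * key
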